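/- Let T be a commutative F-algebra, J ⊆ T an ideal with J² = 0, and D a central simple F-algebra of degree p where F contains a primitive p-th root of unity ρ (p odd prime, char F coprime to p). Suppose α, β ∈ (D ⊗_F T/J)^* satisfy αβ = ρβα. Then there exist lifts α', β' ∈ D ⊗_F T of α, β that are invertible and satisfy α'β' = ρβ'α'. (Infinitesimal lifting / formal smoothness of the variety of skew-commuting invertible pairs.) -/

import Mathlib

open scoped TensorProduct

section SkewCommuting

variable {R B : Type*} [CommRing R] [Ring B] [Algebra R B]

lemma skew_pow_right {ρ : R} {a b : B} (h : a * b = ρ • (b * a)) (j : ℕ) :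
    a * b ^ j = ρ ^ j • (b ^ j * a) := by
  induction j with
  | zero => simp
  | succ j ih =>
    rw [pow_succ, ← mul_assoc, ih, smul_mul_assoc, mul_assoc, h, mul_smul_comm, smul_smul,
      ← mul_assoc, pow_succ]

lemma skew_pow_left {ρ : R} {a b : B} (h : a * b = ρ • (b * a)) (i : ℕ) :
    a ^ i * b = ρ ^ i • (b * a ^ i) := by
  induction i with
  | zero => simp
  | succ i ih =>
    rw [pow_succ', mul_assoc, ih, mul_smul_comm, ← mul_assoc, h, smul_mul_assoc, smul_smul,
      mul_assoc, pow_succ]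

/-- The trace of left multiplication; `Algebra.trace` requires a commutative algebra. -/
noncomputable def regularTrace (R B : Type*) [CommRing R] [Ring B] [Algebra R B] : B →ₗ[R] R :=
  LinearMap.trace R B ∘ₗ (Algebra.lmul R B).toLinearMap

lemma regularTrace_mul_comm (x y : B) :
    regularTrace R B (x * y) = regularTrace R B (y * x) := by
  simp only [regularTrace, LinearMap.comp_apply, AlgHom.toLinearMap_apply, map_mul]
  exact LinearMap.trace_mul_comm R _ _

lemma regularTrace_one {ι : Type*} [Fintype ι] (e : Module.Basis ι R B) :
    regularTrace R B 1 = Fintype.card ι := by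
  classical
  rw [regularTrace, LinearMap.comp_apply, AlgHom.toLinearMap_apply, map_one,
    LinearMap.trace_eq_matrix_trace R e, LinearMap.toMatrix_one, Matrix.trace_one]

/-- An element which is an eigenvector of conjugation by a unit, with eigenvalue sufficiently
different from one, has trace zero. -/
lemma regularTrace_eq_zero_of_skew {s q : B} (hs : IsUnit s) {μ ν : R} (hμν : IsUnit (ν - μ))
    (h : ν • (s * q) = μ • (q * s)) : regularTrace R B q = 0 := by
  obtain ⟨s, rfl⟩ := hs
  have hconj : regularTrace R B (s * q * ↑s⁻¹) = regularTrace R B q := by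
    rw [regularTrace_mul_comm, ← mul_assoc, Units.inv_mul, one_mul]
  have h' : ν • (s * q * ↑s⁻¹) = μ • q := by
    rw [← smul_mul_assoc, h, smul_mul_assoc, mul_assoc, Units.mul_inv, mul_one]
  have := congrArg (regularTrace R B) h'
  rw [map_smul, map_smul, hconj, smul_eq_mul, smul_eq_mul, ← sub_eq_zero, ← sub_mul] at this
  exact (hμν.mul_right_eq_zero).1 this

/-- In an algebra that is free of rank `p ^ 2`, the monomials in two skew-commuting units span. -/
lemma span_skew_monomials {p : ℕ} (e : Module.Basis (Fin p × Fin p) R B) (hp : IsUnit (p : R))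
    {ρ : R} (hρ : ∀ i < p, ∀ j < p, i ≠ j → IsUnit (ρ ^ i - ρ ^ j)) (hρu : IsUnit ρ)
    (a b : Bˣ) (h : (a * b : B) = ρ • (b * a : B)) :
    Submodule.span R
      (Set.range fun k : Fin p × Fin p => (a ^ (k.1 + 1 : ℕ) * b ^ (k.2 + 1 : ℕ) : B)) = ⊤ := by
  set v : Fin p × Fin p → Bˣ := fun k => a ^ (k.1 + 1 : ℕ) * b ^ (k.2 + 1 : ℕ) with hv
  have hav (k) : (a * v k : B) = ρ ^ (k.2 + 1 : ℕ) • (v k * a : B) := by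
    have := skew_pow_right h (k.2 + 1)
    simp only [hv, Units.val_mul, Units.val_pow_eq_pow_val]
    rw [← mul_assoc, ← pow_succ', pow_succ, mul_assoc, this, mul_smul_comm, mul_assoc]
  have hvb (k) : (v k * b : B) = ρ ^ (k.1 + 1 : ℕ) • (b * v k : B) := by
    have := skew_pow_left h (k.1 + 1)
    simp only [hv, Units.val_mul, Units.val_pow_eq_pow_val]
    rw [mul_assoc, ← pow_succ, pow_succ' (b : B), ← mul_assoc, this, smul_mul_assoc, mul_assoc]
  have hwa (l) : (↑(v l)⁻¹ * a : B) = ρ ^ (l.2 + 1 : ℕ) • (a * ↑(v l)⁻¹ : B) := by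
    rw [Units.inv_mul_eq_iff_eq_mul, mul_smul_comm, ← mul_assoc, ← smul_mul_assoc, ← hav,
      mul_assoc, Units.mul_inv, mul_one]
  have hbw (l) : (b * ↑(v l)⁻¹ : B) = ρ ^ (l.1 + 1 : ℕ) • (↑(v l)⁻¹ * b : B) := by
    rw [Units.mul_inv_eq_iff_eq_mul, smul_mul_assoc, mul_assoc, ← mul_smul_comm, ← hvb,
      ← mul_assoc, Units.inv_mul, one_mul]
  have hdiff {i j : Fin p} (hij : i ≠ j) :
      IsUnit (ρ ^ (i + 1 : ℕ) - ρ ^ (j + 1 : ℕ)) := by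
    rw [pow_succ, pow_succ, ← sub_mul]
    exact (hρ i i.2 j j.2 (Fin.val_injective.ne hij)).mul hρu
  have htr (l k) : regularTrace R B (↑(v l)⁻¹ * v k) = if l = k then (p : R) ^ 2 else 0 := by
    split_ifs with hlk
    · subst hlk
      rw [Units.inv_mul, regularTrace_one e]
      simp [sq]
    · by_cases h2 : l.2 = k.2
      · have h1 : k.1 ≠ l.1 := fun h1 => hlk (Prod.ext h1.symm h2)
        refine regularTrace_eq_zero_of_skew b.isUnit (hdiff h1) ?_
        rw [← mul_assoc, hbw, mul_assoc, hvb, smul_mul_assoc, mul_smul_comm, mul_assoc, smul_comm]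
      · refine regularTrace_eq_zero_of_skew a.isUnit (hdiff h2) ?_
        rw [← mul_assoc, ← smul_mul_assoc, ← hwa, mul_assoc, hav, mul_smul_comm, mul_assoc]
  let φ : (Fin p × Fin p → R) →ₗ[R] B := Fintype.linearCombination R fun k => (v k : B)
  let ψ : B →ₗ[R] (Fin p × Fin p → R) :=
    LinearMap.pi fun l => regularTrace R B ∘ₗ LinearMap.mulLeft R (↑(v l)⁻¹ : B)
  have hψφ (c) : ψ (φ c) = (p : R) ^ 2 • c := by
    ext l
    simp [φ, ψ, Fintype.linearCombination_apply, htr, mul_comm]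
  obtain ⟨u, hu⟩ := hp.pow 2
  have hψφ' (c) : ψ (φ ((↑u⁻¹ : R) • c)) = c := by
    rw [hψφ, smul_smul, ← hu, Units.mul_inv, one_smul]
  have := Module.Finite.of_basis e
  have hinj : Function.Injective (e.equivFun.symm.toLinearMap ∘ₗ ψ) :=
    OrzechProperty.injective_of_surjective_endomorphism _
      (e.equivFun.symm.surjective.comp fun c => ⟨_, hψφ' c⟩)
  have hψ : Function.Injective ψ := Function.Injective.of_comp (f := e.equivFun.symm) hinj
  have hφ : Function.Surjective φ := fun x => ⟨_, hψ (hψφ' (ψ x))⟩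
  have hr := LinearMap.range_eq_top.2 hφ
  rw [Fintype.range_linearCombination] at hr
  simpa [hv] using hr

/-- Up to a multiple of `b * a`, every element is in the image of the derivative of
`(a, b) ↦ a * b - ρ • (b * a)` at a skew-commuting pair of units. -/
lemma exists_eq_skew_derivative {p : ℕ} (e : Module.Basis (Fin p × Fin p) R B)
    (hp : IsUnit (p : R)) {ρ : R} (hρ : ∀ i < p, ∀ j < p, i ≠ j → IsUnit (ρ ^ i - ρ ^ j))
    (hρu : IsUnit ρ) {a b : B} (ha : IsUnit a) (hb : IsUnit b) (h : a * b = ρ • (b * a)) (c : B) :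
    ∃ (r : R) (x y : B),
      c = r • (b * a) + (x * b - ρ • (b * x)) + (a * y - ρ • (y * a)) := by
  have hc : c ∈ Submodule.span R
      (Set.range fun k : Fin p × Fin p => (a ^ (k.1 + 1 : ℕ) * b ^ (k.2 + 1 : ℕ) : B)) := by
    obtain ⟨a, rfl⟩ := ha
    obtain ⟨b, rfl⟩ := hb
    rw [span_skew_monomials e hp hρ hρu a b h]
    trivial
  induction hc using Submodule.span_induction with
  | mem c hc =>
    obtain ⟨⟨i, j⟩, rfl⟩ := hc
    have hp0 : 0 < p := i.pos
    dsimp only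
    by_cases hi : (i : ℕ) = 0
    · by_cases hj : (j : ℕ) = 0
      · exact ⟨ρ, 0, 0, by simp [hi, hj, h]⟩
      · obtain ⟨u, hu⟩ := hρ j j.2 0 hp0 hj
        refine ⟨0, 0, (↑u⁻¹ * ρ ^ (j : ℕ) : R) • (a ^ (i : ℕ) * b ^ (j + 1 : ℕ)), ?_⟩
        have h1 : a ^ (i : ℕ) * b ^ (j + 1 : ℕ) * a =
            a ^ (i : ℕ) * (b ^ (j + 1 : ℕ) * a) := mul_assoc _ _ _
        have h2 : a * (a ^ (i : ℕ) * b ^ (j + 1 : ℕ)) =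
            a ^ (i + 1 : ℕ) * b ^ (j + 1 : ℕ) := by rw [← mul_assoc, ← pow_succ']
        have h3 : ρ ^ (j + 1 : ℕ) • (a ^ (i : ℕ) * (b ^ (j + 1 : ℕ) * a)) =
            a ^ (i + 1 : ℕ) * b ^ (j + 1 : ℕ) := by
          rw [← mul_smul_comm, ← skew_pow_right h, ← mul_assoc, ← pow_succ]
        have h4 : (↑u⁻¹ : R) * (ρ ^ (j : ℕ) - 1) = 1 := by
          simpa only [hu, pow_zero] using u.inv_mul
        rw [zero_smul, zero_mul, mul_zero, smul_zero, sub_zero, add_zero, zero_add,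
          mul_smul_comm, smul_mul_assoc, h1, h2, smul_smul,
          show ρ * (↑u⁻¹ * ρ ^ (j : ℕ)) = ↑u⁻¹ * ρ ^ (j + 1 : ℕ) by ring, mul_smul _ (ρ ^ (_ + 1)),
          h3, ← sub_smul, ← mul_sub_one, h4, one_smul]
    · obtain ⟨u, hu⟩ := hρ i i.2 0 hp0 hi
      refine ⟨0, (↑u⁻¹ * ρ ^ (i : ℕ) : R) • (a ^ (i + 1 : ℕ) * b ^ (j : ℕ)), 0, ?_⟩
      have h1 : b * (a ^ (i + 1 : ℕ) * b ^ (j : ℕ)) =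
          (b * a ^ (i + 1 : ℕ)) * b ^ (j : ℕ) := (mul_assoc _ _ _).symm
      have h2 : a ^ (i + 1 : ℕ) * b ^ (j : ℕ) * b =
          a ^ (i + 1 : ℕ) * b ^ (j + 1 : ℕ) := by rw [mul_assoc, ← pow_succ]
      have h3 : ρ ^ (i + 1 : ℕ) • ((b * a ^ (i + 1 : ℕ)) * b ^ (j : ℕ)) =
          a ^ (i + 1 : ℕ) * b ^ (j + 1 : ℕ) := by
        rw [← smul_mul_assoc, ← skew_pow_left h, mul_assoc, ← pow_succ']
      have h4 : (↑u⁻¹ : R) * (ρ ^ (i : ℕ) - 1) = 1 := by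
        simpa only [hu, pow_zero] using u.inv_mul
      rw [zero_smul, zero_mul, mul_zero, smul_zero, sub_zero, add_zero, zero_add,
        mul_smul_comm, smul_mul_assoc, h1, h2, smul_smul,
        show ρ * (↑u⁻¹ * ρ ^ (i : ℕ)) = ↑u⁻¹ * ρ ^ (i + 1 : ℕ) by ring, mul_smul _ (ρ ^ (_ + 1)),
        h3, ← sub_smul, ← mul_sub_one, h4, one_smul]
  | zero => exact ⟨0, 0, 0, by simp⟩
  | add c d _ _ hc hd =>
    obtain ⟨r, x, y, rfl⟩ := hc
    obtain ⟨r', x', y', rfl⟩ := hd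
    refine ⟨r + r', x + x', y + y', ?_⟩
    simp only [add_smul, add_mul, mul_add, smul_add]
    abel
  | smul t c _ hc =>
    obtain ⟨r, x, y, rfl⟩ := hc
    refine ⟨t * r, t • x, t • y, ?_⟩
    simp only [smul_add, smul_sub, mul_smul, smul_mul_assoc, mul_smul_comm, smul_comm t ρ]

/-- A scalar by which two units commute is a root of unity. -/
lemma pow_card_eq_one_of_skew {ι : Type*} [Fintype ι] (e : Module.Basis ι R B) {c : R} {a b : B}
    (ha : IsUnit a) (hb : IsUnit b) (h : a * b = c • (b * a)) : c ^ Fintype.card ι = 1 := by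
  have hn := congrArg (Algebra.norm R) h
  rw [Algebra.smul_def, map_mul, map_mul, map_mul, Algebra.norm_algebraMap_of_basis e,
    mul_comm (Algebra.norm R b)] at hn
  exact ((ha.map (Algebra.norm R)).mul (hb.map (Algebra.norm R))).mul_right_cancel
    (hn.symm.trans (one_mul _).symm)

lemma add_pow_succ_of_mul_self_eq_zero {r : R} (hr : r * r = 0) (x : R) (n : ℕ) :
    (x + r) ^ (n + 1) = x ^ (n + 1) + (n + 1) * x ^ n * r := by
  induction n with
  | zero => simp
  | succ n ih =>
    rw [pow_succ, ih]
    push_cast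
    linear_combination ((n + 1) * x ^ n) * hr

end SkewCommuting

section SquareZero

variable {T A : Type*} [CommRing T] [Ring A] [Algebra T A] {J : Ideal T}

lemma smul_eq_zero_of_mem_smul_top (hJ : J * J = ⊥) {t : T} (ht : t ∈ J) {x : A}
    (hx : x ∈ J • (⊤ : Submodule T A)) : t • x = 0 := by
  induction hx using Submodule.smul_induction_on' with
  | smul s hs y _ =>
    have : t * s = 0 := by simpa [hJ] using Ideal.mul_mem_mul ht hs
    rw [smul_smul, this, zero_smul]
  | add x _ y _ hx hy => rw [smul_add, hx, hy, add_zero]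

lemma mul_eq_zero_of_mem_smul_top (hJ : J * J = ⊥) {x y : A}
    (hx : x ∈ J • (⊤ : Submodule T A)) (hy : y ∈ J • (⊤ : Submodule T A)) : x * y = 0 := by
  induction hx using Submodule.smul_induction_on' with
  | smul s hs z _ =>
    rw [smul_mul_assoc, ← mul_smul_comm, smul_eq_zero_of_mem_smul_top hJ hs hy, mul_zero]
  | add x _ z _ hx hz => rw [add_mul, hx, hz, add_zero]

lemma isUnit_of_isUnit_map_of_ker_mul_eq_zero {A B : Type*} [Ring A] [Ring B] (f : A →+* B)
    (hf : Function.Surjective f) (hker : ∀ x, f x = 0 → x * x = 0) {a : A}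
    (ha : IsUnit (f a)) : IsUnit a := by
  have key (x : A) (hx : f x = 1) : IsUnit x := by
    have hn : IsNilpotent (x - 1) := ⟨2, by rw [sq]; exact hker _ (by simp [hx])⟩
    simpa using hn.isUnit_one_add
  obtain ⟨u, hu⟩ := ha
  obtain ⟨c, hc⟩ := hf ↑u⁻¹
  obtain ⟨v, hv⟩ := key (a * c) (by simp [hc, ← hu])
  obtain ⟨w, hw⟩ := key (c * a) (by simp [hc, ← hu])
  refine isUnit_iff_exists_and_exists.2 ⟨⟨c * ↑v⁻¹, ?_⟩, ⟨↑w⁻¹ * c, ?_⟩⟩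
  · rw [← mul_assoc, ← hv, Units.mul_inv]
  · rw [mul_assoc, ← hw, Units.inv_mul]

/-- Skew-commuting pairs of units lift along square-zero extensions of the base ring. -/
theorem exists_lift_skew_units {B : Type*} [Ring B] [Algebra (T ⧸ J) B] (hJ : J * J = ⊥)
    (f : A →+* B) (hfalg : ∀ t : T, f (algebraMap T A t) = algebraMap (T ⧸ J) B t)
    (hf : Function.Surjective f) (hker : ∀ x, f x = 0 ↔ x ∈ J • (⊤ : Submodule T A))
    {p : ℕ} (hp0 : 0 < p) (e : Module.Basis (Fin p × Fin p) T A)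
    (e' : Module.Basis (Fin p × Fin p) (T ⧸ J) B)
    (hp : IsUnit (p : T)) {ρ : T} (hρ : ∀ i < p, ∀ j < p, i ≠ j → IsUnit (ρ ^ i - ρ ^ j))
    (hρ1 : ρ ^ p = 1) {α β : B} (hα : IsUnit α) (hβ : IsUnit β)
    (h : α * β = (Ideal.Quotient.mk J ρ) • (β * α)) :
    ∃ a b : A, f a = α ∧ f b = β ∧ IsUnit a ∧ IsUnit b ∧ a * b = ρ • (b * a) := by
  have hsmul (t : T) (x : A) : f (t • x) = Ideal.Quotient.mk J t • f x := by
    rw [Algebra.smul_def, map_mul, hfalg]; exact (Algebra.smul_def _ _).symm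
  have hρu : IsUnit ρ := IsUnit.of_pow_eq_one hρ1 hp0.ne'
  have hunit {a : A} (ha : IsUnit (f a)) : IsUnit a :=
    isUnit_of_isUnit_map_of_ker_mul_eq_zero f hf (fun x hx =>
      mul_eq_zero_of_mem_smul_top hJ ((hker x).1 hx) ((hker x).1 hx)) ha
  obtain ⟨a, rfl⟩ := hf α
  obtain ⟨b, rfl⟩ := hf β
  have key (c : A) (hc : c ∈ J • (⊤ : Submodule T A)) :
      ∃ r ∈ J, ∃ x ∈ J • (⊤ : Submodule T A), ∃ y ∈ J • (⊤ : Submodule T A),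
        c = r • (b * a) + (x * b - ρ • (b * x)) + (a * y - ρ • (y * a)) := by
    induction hc using Submodule.smul_induction_on' with
    | smul t ht m _ =>
      obtain ⟨r, x, y, hm⟩ := exists_eq_skew_derivative e'
        (by simpa using hp.map (Ideal.Quotient.mk J))
        (fun i hi j hj hij => by simpa using (hρ i hi j hj hij).map (Ideal.Quotient.mk J))
        (hρu.map (Ideal.Quotient.mk J)) hα hβ h (f m)
      obtain ⟨r, rfl⟩ := Ideal.Quotient.mk_surjective r
      obtain ⟨x, rfl⟩ := hf x
      obtain ⟨y, rfl⟩ := hf y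
      refine ⟨t * r, J.mul_mem_right r ht, t • x, Submodule.smul_mem_smul ht trivial,
        t • y, Submodule.smul_mem_smul ht trivial, ?_⟩
      have hd := smul_eq_zero_of_mem_smul_top hJ ht
        ((hker (m - (r • (b * a) + (x * b - ρ • (b * x)) + (a * y - ρ • (y * a))))).1
          (by simp only [map_sub, map_add, hsmul, map_mul, hm, sub_self]))
      rw [smul_sub, sub_eq_zero] at hd
      rw [hd]
      simp only [smul_add, smul_sub, mul_smul, smul_mul_assoc, mul_smul_comm, smul_comm t ρ]
    | add c _ d _ hc hd =>
      obtain ⟨r, hr, x, hx, y, hy, rfl⟩ := hc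
      obtain ⟨r', hr', x', hx', y', hy', rfl⟩ := hd
      refine ⟨r + r', add_mem hr hr', x + x', add_mem hx hx', y + y', add_mem hy hy', ?_⟩
      simp only [add_smul, add_mul, mul_add, smul_add]
      abel
  obtain ⟨r, hr, x, hx, y, hy, hc⟩ := key (a * b - ρ • (b * a))
    ((hker _).1 (by rw [map_sub, hsmul, map_mul, map_mul, h, sub_self]))
  have hfx : f (a - x) = f a := by rw [map_sub, (hker x).2 hx, sub_zero]
  have hfy : f (b - y) = f b := by rw [map_sub, (hker y).2 hy, sub_zero]
  have hua : IsUnit (a - x) := hunit (hfx ▸ hα)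
  have hub : IsUnit (b - y) := hunit (hfy ▸ hβ)
  have hskew : (a - x) * (b - y) = (ρ + r) • ((b - y) * (a - x)) := by
    have h1 : r • (y * a) = 0 := by
      rw [← smul_mul_assoc, smul_eq_zero_of_mem_smul_top hJ hr hy, zero_mul]
    have h2 : r • (b * x) = 0 := by
      rw [← mul_smul_comm, smul_eq_zero_of_mem_smul_top hJ hr hx, mul_zero]
    have h3 := mul_eq_zero_of_mem_smul_top hJ hx hy
    have h4 := mul_eq_zero_of_mem_smul_top hJ hy hx
    rw [sub_eq_iff_eq_add] at hc
    simp only [sub_mul, mul_sub, add_smul, smul_sub, h1, h2, h3, h4, hc, smul_zero]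
    abel
  have hrr : r * r = 0 := by simpa [hJ] using Ideal.mul_mem_mul hr hr
  have hr0 : r = 0 := by
    have hpow := pow_card_eq_one_of_skew e hua hub hskew
    obtain ⟨n, hn⟩ : ∃ n, Fintype.card (Fin p × Fin p) = n + 1 :=
      Nat.exists_eq_succ_of_ne_zero (by simp [hp0.ne'])
    have hcard : p * p = n + 1 := by simpa using hn
    rw [hn, add_pow_succ_of_mul_self_eq_zero hrr, ← hcard, pow_mul, hρ1, one_pow,
      add_eq_left] at hpow
    refine IsUnit.mul_right_eq_zero (IsUnit.mul ?_ (hρu.pow n)) |>.1 hpow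
    have := hp.mul hp
    rwa [← Nat.cast_mul, hcard, Nat.cast_succ] at this
  rw [hr0, add_zero] at hskew
  exact ⟨a - x, b - y, hfx, hfy, hua, hub, hskew⟩

end SquareZero

theorem stmt17 (F : Type*) [Field F] (p : ℕ) (hp : p.Prime) (hodd : Odd p)
    (hchar : (p : F) ≠ 0) (ρ : F) (hρ : IsPrimitiveRoot ρ p)
    (D : Type*) [Ring D] [Algebra F D] [Algebra.IsCentral F D] [IsSimpleRing D]
    (hdeg : Module.finrank F D = p ^ 2)
    (T : Type*) [CommRing T] [Algebra F T] (J : Ideal T) (hJ : J * J = ⊥)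
    (α β : D ⊗[F] (T ⧸ J)) (hα : IsUnit α) (hβ : IsUnit β)
    (hcomm : α * β = ρ • (β * α)) :
    ∃ α' β' : D ⊗[F] T,
      Algebra.TensorProduct.map (AlgHom.id F D) (Ideal.Quotient.mkₐ F J) α' = α ∧
      Algebra.TensorProduct.map (AlgHom.id F D) (Ideal.Quotient.mkₐ F J) β' = β ∧
      IsUnit α' ∧ IsUnit β' ∧ α' * β' = ρ • (β' * α') := by
  have hfin : Module.Finite F D :=
    Module.finite_of_finrank_pos (by rw [hdeg]; exact pow_pos hp.pos 2)
  let d : Module.Basis (Fin p × Fin p) F D :=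
    (Module.finBasisOfFinrankEq F D (hdeg.trans (sq p))).reindex finProdFinEquiv.symm
  let e := Algebra.TensorProduct.basis T d
  let e' := Algebra.TensorProduct.basis (T ⧸ J) d
  let σ := Algebra.TensorProduct.comm F D T
  let σ' := Algebra.TensorProduct.comm F D (T ⧸ J)
  let g := Algebra.TensorProduct.map (AlgHom.id F D) (Ideal.Quotient.mkₐ F J)
  let f : T ⊗[F] D →ₐ[F] (T ⧸ J) ⊗[F] D :=
    Algebra.TensorProduct.map (Ideal.Quotient.mkₐ F J) (AlgHom.id F D)
  have hfg (x) : f (σ x) = σ' (g x) := by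
    have : f.comp σ.toAlgHom = σ'.toAlgHom.comp g := by
      ext x <;> simp [f, g, σ, σ']
    exact DFunLike.congr_fun this x
  have hfalg (t : T) : f (algebraMap T _ t) = algebraMap (T ⧸ J) _ t := by
    simp [f, Algebra.TensorProduct.algebraMap_apply]
  have hsmul (t : T) (x) : f (t • x) = Ideal.Quotient.mk J t • f x := by
    rw [Algebra.smul_def, map_mul, hfalg]; exact (Algebra.smul_def _ _).symm
  have hfe (k) : f (e k) = e' k := by simp [f, e, e']
  have hf : Function.Surjective f :=
    TensorProduct.map_surjective Ideal.Quotient.mk_surjective Function.surjective_id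
  have hker (x) : f x = 0 ↔ x ∈ J • (⊤ : Submodule T (T ⊗[F] D)) := by
    constructor
    · intro hx
      rw [← e.sum_repr x] at hx ⊢
      simp only [map_sum, hsmul, hfe] at hx
      refine Submodule.sum_mem _ fun k _ => Submodule.smul_mem_smul ?_ trivial
      exact Ideal.Quotient.eq_zero_iff_mem.1
        (Fintype.linearIndependent_iff.1 e'.linearIndependent _ hx k)
    · intro hx
      induction hx using Submodule.smul_induction_on' with
      | smul t ht m _ => rw [hsmul, Ideal.Quotient.eq_zero_iff_mem.2 ht, zero_smul]
      | add x _ y _ hx hy => rw [map_add, hx, hy, add_zero]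
  obtain ⟨a, b, ha, hb, hua, hub, hab⟩ := exists_lift_skew_units hJ f.toRingHom hfalg hf hker
    hp.pos e e' (by simpa using (IsUnit.mk0 _ hchar).map (algebraMap F T))
    (ρ := algebraMap F T ρ)
    (fun i hi j hj hij => by
      simpa using (IsUnit.mk0 (ρ ^ i - ρ ^ j)
        (sub_ne_zero.2 fun h => hij (hρ.pow_inj hi hj h))).map (algebraMap F T))
    (by rw [← map_pow, hρ.pow_eq_one, map_one])
    (hα.map σ') (hβ.map σ')
    (by
      rw [← map_mul, hcomm, map_smul, map_mul]
      exact (algebraMap_smul (T ⧸ J) ρ _).symm)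
  refine ⟨σ.symm a, σ.symm b, σ'.injective ?_, σ'.injective ?_, hua.map σ.symm, hub.map σ.symm, ?_⟩
  · rw [← hfg, σ.apply_symm_apply]; exact ha
  · rw [← hfg, σ.apply_symm_apply]; exact hb
  · rw [← map_mul, hab, algebraMap_smul, map_smul, map_mul]
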